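/- arXiv:2602.24105 — 2 statements merged into one kernel-verified Lean document; each statement's English description precedes it below -/
import Mathlib

section
/- For every integer n ≥ 2, the number of matrices A = (a_{ij}) ∈ Δ_{n+2}^2 with a_{2,2} = 0 equals δ(n+1,2); explicitly, the map that changes the entry a_{2,2} from 0 to 1 and then removes the first row and first column is a bijection from {A ∈ Δ_{n+2}^2 : a_{2,2} = 0} onto Δ_{n+1}^2. -/
/-- The integer encoded (in binary, most significant digit first) by the `i`-th row
of the binary matrix `A`, i.e. `x_i = ∑_j a_{ij} 2^{m-j}` (1-indexed). -/
def rowVal {n m : ℕ} (A : Fin n → Fin m → Fin 2) (i : Fin n) : ℕ :=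
  ∑ j : Fin m, (A i j : ℕ) * 2 ^ (m - 1 - (j : ℕ))

/-- The integer encoded by the `j`-th column of `A`, i.e. `y_j = ∑_i a_{ij} 2^{n-i}`. -/
def colVal {n m : ℕ} (A : Fin n → Fin m → Fin 2) (j : Fin m) : ℕ :=
  ∑ i : Fin n, (A i j : ℕ) * 2 ^ (n - 1 - (i : ℕ))

/-- `A ∈ 𝔠_{n×m}`: rows and columns sorted in lexicographically nondecreasing order. -/
def memC {n m : ℕ} (A : Fin n → Fin m → Fin 2) : Prop :=
  Monotone (rowVal A) ∧ Monotone (colVal A)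

/-- `A ∈ 𝔡_{n×m}`: rows and columns sorted in lexicographically nonincreasing order. -/
def memD {n m : ℕ} (A : Fin n → Fin m → Fin 2) : Prop :=
  Antitone (rowVal A) ∧ Antitone (colVal A)

/-- `Λ_n^k`: n×n binary matrices with exactly `k` ones in each row and each column. -/
def lambdaSet (n k : ℕ) : Set (Fin n → Fin n → Fin 2) :=
  {A | (∀ i, ∑ j, (A i j : ℕ) = k) ∧ (∀ j, ∑ i, (A i j : ℕ) = k)}

/-- `Γ_n^k = 𝔠_{n×n} ∩ Λ_n^k`. -/
def GammaSet (n k : ℕ) : Set (Fin n → Fin n → Fin 2) :=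
  {A | memC A} ∩ lambdaSet n k

/-- `Δ_n^k = 𝔡_{n×n} ∩ Λ_n^k`. -/
def DeltaSet (n k : ℕ) : Set (Fin n → Fin n → Fin 2) :=
  {A | memD A} ∩ lambdaSet n k

/-- `γ(n,k) = |Γ_n^k|`. -/
noncomputable def gammaCard (n k : ℕ) : ℕ := (GammaSet n k).ncard

/-- `δ(n,k) = |Δ_n^k|`. -/
noncomputable def deltaCard (n k : ℕ) : ℕ := (DeltaSet n k).ncard

/-- Binary value of a vector, most significant digit first. -/
def bval {m : ℕ} (v : Fin m → Fin 2) : ℕ := ∑ j : Fin m, (v j : ℕ) * 2 ^ (m - 1 - (j : ℕ))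

theorem bval_succ {m : ℕ} (v : Fin (m + 1) → Fin 2) :
    bval v = (v 0 : ℕ) * 2 ^ m + bval (fun j => v j.succ) := by
  unfold bval
  rw [Fin.sum_univ_succ]
  congr 1
  apply Finset.sum_congr rfl
  intro j _
  congr 2
  simp only [Fin.val_succ]
  omega

theorem bval_lt {m : ℕ} (v : Fin m → Fin 2) : bval v < 2 ^ m := by
  induction m with
  | zero => simp [bval]
  | succ m ih =>
    rw [bval_succ, pow_succ]
    have h1 := ih (fun j => v j.succ)
    have h2 : (v 0 : ℕ) * 2 ^ m ≤ 1 * 2 ^ m := Nat.mul_le_mul_right _ (by omega)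
    omega

theorem fin2_cases (x : Fin 2) : x = 0 ∨ x = 1 := by omega

theorem bval_head_lt {m : ℕ} {v w : Fin (m + 1) → Fin 2} (hv : v 0 = 0) (hw : w 0 = 1) :
    bval v < bval w := by
  rw [bval_succ, bval_succ w, hv, hw]
  have := bval_lt (fun j => v j.succ)
  simp
  omega

theorem bval_head_le {m : ℕ} {v w : Fin (m + 1) → Fin 2} (h : bval v ≤ bval w) :
    v 0 ≤ w 0 := by
  by_contra hc
  have hv : v 0 = 1 := by omega
  have hw : w 0 = 0 := by omega
  have := bval_head_lt hw hv
  omega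

theorem bval_tail_iff {m : ℕ} {v w : Fin (m + 1) → Fin 2} (h : v 0 = w 0) :
    bval v ≤ bval w ↔ bval (fun j => v j.succ) ≤ bval (fun j => w j.succ) := by
  rw [bval_succ, bval_succ w, h]
  omega

/-- Sorted vectors with two ones. -/
theorem antitone_two {m : ℕ} {v : Fin (m + 1 + 1) → Fin 2} (h : Antitone v)
    (hs : ∑ j, (v j : ℕ) = 2) : v 0 = 1 ∧ v 1 = 1 ∧ ∀ j : Fin m, v j.succ.succ = 0 := by
  rw [Fin.sum_univ_succ, Fin.sum_univ_succ] at hs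
  change (v 0 : ℕ) + ((v 1 : ℕ) + _) = 2 at hs
  have h01 : v 1 ≤ v 0 := h (Fin.zero_le _)
  have h1 : v 1 = 1 := by
    by_contra hc
    have hz : v 1 = 0 := by omega
    have : ∑ i : Fin m, (v i.succ.succ : ℕ) = 0 := by
      apply Finset.sum_eq_zero
      intro i _
      have : v i.succ.succ ≤ v 1 := h (by simp [Fin.le_def])
      omega
    omega
  have h0 : v 0 = 1 := by omega
  refine ⟨h0, h1, fun j => ?_⟩
  have : ∑ i : Fin m, (v i.succ.succ : ℕ) = 0 := by
    rw [h0, h1] at hs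
    simp only [Fin.val_one] at hs
    omega
  have := (Finset.sum_eq_zero_iff.1 this) j (Finset.mem_univ _)
  omega

theorem bval_max {m : ℕ} {v w : Fin (m + 1 + 1) → Fin 2} (hs : ∑ j, (v j : ℕ) = 2)
    (h0 : w 0 = 1) (h1 : w 1 = 1) : bval v ≤ bval w := by
  rcases fin2_cases (v 0) with hv | hv
  · exact (bval_head_lt hv h0).le
  rw [bval_tail_iff (hv.trans h0.symm)]
  rcases fin2_cases (v 1) with hv1 | hv1
  · exact (bval_head_lt (v := fun j => v j.succ) (w := fun j => w j.succ) hv1 h1).le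
  rw [bval_tail_iff (v := fun j => v j.succ) (w := fun j => w j.succ) (hv1.trans h1.symm)]
  rw [Fin.sum_univ_succ, Fin.sum_univ_succ] at hs
  change (v 0 : ℕ) + ((v 1 : ℕ) + _) = 2 at hs
  have : ∑ i : Fin m, (v i.succ.succ : ℕ) = 0 := by
    rw [hv, hv1] at hs
    simp only [Fin.val_one] at hs
    omega
  have h := (Finset.sum_eq_zero_iff.1 this)
  have hz : bval (fun j : Fin m => v j.succ.succ) = 0 := by
    apply Finset.sum_eq_zero
    intro i hi
    rw [h i hi, zero_mul]
  omega

/-- Row half of membership in `Δ`. -/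
def RowOK {n : ℕ} (A : Fin n → Fin n → Fin 2) : Prop :=
  Antitone (fun i => bval (A i)) ∧ ∀ i, ∑ j, (A i j : ℕ) = 2

theorem mem_delta {n : ℕ} (A : Fin n → Fin n → Fin 2) :
    A ∈ DeltaSet n 2 ↔ RowOK A ∧ RowOK (fun i j => A j i) :=
  ⟨fun h => ⟨⟨h.1.1, h.2.1⟩, ⟨h.1.2, h.2.2⟩⟩, fun h => ⟨⟨h.1.1, h.2.1⟩, ⟨h.1.2, h.2.2⟩⟩⟩

theorem first_row {m : ℕ} {A : Fin (m + 1 + 1) → Fin (m + 1 + 1) → Fin 2}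
    (h : RowOK A) (h' : RowOK (fun i j => A j i)) :
    A 0 0 = 1 ∧ A 0 1 = 1 ∧ ∀ j : Fin m, A 0 j.succ.succ = 0 :=
  antitone_two (v := A 0) (fun _ _ hab => bval_head_le (h'.1 hab)) (h.2 0)

/-- The map of the theorem. -/
def shrink {m : ℕ} (A : Fin (m + 1 + 1) → Fin (m + 1 + 1) → Fin 2) (i j : Fin (m + 1)) : Fin 2 :=
  if (i : ℕ) = 0 ∧ (j : ℕ) = 0 then 1 else A i.succ j.succ

theorem shrink_zero {m : ℕ} (A : Fin (m + 1 + 1) → Fin (m + 1 + 1) → Fin 2) :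
    shrink A 0 0 = 1 := by simp [shrink]

theorem shrink_row {m : ℕ} (A : Fin (m + 1 + 1) → Fin (m + 1 + 1) → Fin 2) (i : Fin m)
    (j : Fin (m + 1)) : shrink A i.succ j = A i.succ.succ j.succ := by simp [shrink]

theorem shrink_col {m : ℕ} (A : Fin (m + 1 + 1) → Fin (m + 1 + 1) → Fin 2) (i : Fin (m + 1))
    (j : Fin m) : shrink A i j.succ = A i.succ j.succ.succ := by simp [shrink]

theorem shrink_tr {m : ℕ} (A : Fin (m + 1 + 1) → Fin (m + 1 + 1) → Fin 2) :
    (fun i j => shrink A j i) = shrink (fun i j => A j i) := by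
  funext i j
  simp [shrink, and_comm]

theorem shrink_rowOK {m : ℕ} {A : Fin (m + 1 + 1 + 1) → Fin (m + 1 + 1 + 1) → Fin 2}
    (h : RowOK A) (h' : RowOK (fun i j => A j i)) (h11 : A 1 1 = 0) : RowOK (shrink A) := by
  obtain ⟨r0, r1, r2⟩ := first_row h h'
  obtain ⟨_, c1, c2⟩ := first_row h' h
  have hs : ∀ i, ∑ j, (shrink A i j : ℕ) = 2 := by
    intro i
    refine Fin.cases ?_ (fun i => ?_) i
    · have := h.2 1
      rw [Fin.sum_univ_succ, Fin.sum_univ_succ] at this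
      change (A 1 0 : ℕ) + ((A 1 1 : ℕ) + _) = 2 at this
      rw [c1, h11] at this
      rw [Fin.sum_univ_succ, shrink_zero]
      simp only [shrink_col]
      simpa using this
    · have := h.2 i.succ.succ
      rw [Fin.sum_univ_succ, c2] at this
      simp only [shrink_row]
      simpa using this
  refine ⟨?_, hs⟩
  have hanti : Antitone (shrink A 0) := by
    intro a b
    refine Fin.cases ?_ (fun a => ?_) a
    · intro _
      rw [shrink_zero]
      omega
    · refine Fin.cases ?_ (fun b => ?_) b
      · intro hab
        simp at hab
      · intro hab
        rw [shrink_col, shrink_col]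
        have h1 := h'.1 (show a.succ.succ ≤ b.succ.succ by simpa using hab)
        have h2 := (bval_tail_iff (v := fun i => A i b.succ.succ) (w := fun i => A i a.succ.succ)
          ((r2 b).trans (r2 a).symm)).1 h1
        exact bval_head_le h2
  obtain ⟨s0, s1, _⟩ := antitone_two hanti (hs 0)
  intro a b
  refine Fin.cases ?_ (fun a => ?_) a
  · intro _
    exact bval_max (hs b) s0 s1
  · refine Fin.cases ?_ (fun b => ?_) b
    · intro hab
      simp at hab
    · intro hab
      have h1 := h.1 (show a.succ.succ ≤ b.succ.succ by simpa using hab)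
      have h2 := (bval_tail_iff (v := A b.succ.succ) (w := A a.succ.succ)
          ((c2 b).trans (c2 a).symm)).1 h1
      have e : ∀ c : Fin (m + 1), shrink A c.succ = fun j => A c.succ.succ j.succ :=
        fun c => funext fun j => shrink_row A c j
      simpa only [e] using h2

/-- The inverse map. -/
def grow {m : ℕ} (B : Fin (m + 1) → Fin (m + 1) → Fin 2) (i j : Fin (m + 1 + 1)) : Fin 2 :=
  Fin.cases (if (j : ℕ) ≤ 1 then 1 else 0)
    (fun i' => Fin.cases (if (i' : ℕ) = 0 then 1 else 0)
      (fun j' => if (i' : ℕ) = 0 ∧ (j' : ℕ) = 0 then 0 else B i' j') j) i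

theorem grow_tr {m : ℕ} (B : Fin (m + 1) → Fin (m + 1) → Fin 2) :
    (fun i j => grow B j i) = grow (fun i j => B j i) := by
  funext i j
  refine Fin.cases ?_ (fun i => ?_) i <;> refine Fin.cases ?_ (fun j => ?_) j <;>
    simp [grow, and_comm]

theorem grow_rowOK {m : ℕ} {B : Fin (m + 1 + 1) → Fin (m + 1 + 1) → Fin 2}
    (h : RowOK B) (h' : RowOK (fun i j => B j i)) : RowOK (grow B) := by
  obtain ⟨r0, r1, r2⟩ := first_row h h'
  have hs : ∀ i, ∑ j, (grow B i j : ℕ) = 2 := by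
    intro i
    refine Fin.cases ?_ (fun i => Fin.cases ?_ (fun i => ?_) i) i
    · rw [Fin.sum_univ_succ, Fin.sum_univ_succ]
      simp [grow]
    · have := h.2 0
      rw [Fin.sum_univ_succ, r0] at this
      rw [Fin.sum_univ_succ, Fin.sum_univ_succ]
      simpa [grow, -Fin.succ_zero_eq_one, -Fin.succ_zero_eq_one'] using this
    · have := h.2 i.succ
      rw [Fin.sum_univ_succ]
      simpa [grow] using this
  refine ⟨?_, hs⟩
  intro a b
  refine Fin.cases ?_ (fun a => ?_) a
  · intro _
    exact bval_max (hs b) (by simp [grow]) (by simp [grow])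
  refine Fin.cases ?_ (fun b => ?_) b
  · intro hab
    simp at hab
  refine Fin.cases ?_ (fun b => ?_) b
  · intro hab
    have : a = 0 := by simpa [-Fin.succ_zero_eq_one, -Fin.succ_zero_eq_one'] using hab
    rw [this]
  refine Fin.cases ?_ (fun a => ?_) a
  · intro _
    exact (bval_head_lt (by simp [grow]) (by simp [grow, -Fin.succ_zero_eq_one, -Fin.succ_zero_eq_one'])).le
  intro hab
  have h1 := h.1 (show a.succ ≤ b.succ by simpa using hab)
  refine (bval_tail_iff (by simp [grow])).2 ?_
  simpa [grow] using h1

theorem shrink_grow {m : ℕ} {B : Fin (m + 1) → Fin (m + 1) → Fin 2} (h : B 0 0 = 1) :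
    shrink (grow B) = B := by
  funext i j
  by_cases hij : (i : ℕ) = 0 ∧ (j : ℕ) = 0
  · have hi : i = 0 := Fin.ext hij.1
    have hj : j = 0 := Fin.ext hij.2
    rw [hi, hj, h, shrink_zero]
  · simp only [shrink, grow, if_neg hij, Fin.cases_succ]

theorem grow_shrink {m : ℕ} {A : Fin (m + 1 + 1) → Fin (m + 1 + 1) → Fin 2}
    (h : RowOK A) (h' : RowOK (fun i j => A j i)) (h11 : A 1 1 = 0) : grow (shrink A) = A := by
  obtain ⟨r0, r1, r2⟩ := first_row h h'
  obtain ⟨_, c1, c2⟩ := first_row h' h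
  funext i j
  refine Fin.cases ?_ (fun i => ?_) i
  · refine Fin.cases ?_ (fun j => Fin.cases ?_ (fun j => ?_) j) j
    · simp [grow, r0]
    · simp [grow, r1]
    · simp [grow, r2]
  · refine Fin.cases ?_ (fun j => ?_) j
    · refine Fin.cases ?_ (fun i => ?_) i
      · exact c1.symm
      · simpa [grow] using (c2 i).symm
    · by_cases hij : (i : ℕ) = 0 ∧ (j : ℕ) = 0
      · have hi : i = 0 := Fin.ext hij.1
        have hj : j = 0 := Fin.ext hij.2
        subst hi hj
        exact h11.symm
      · simp only [shrink, grow, if_neg hij, Fin.cases_succ]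

theorem shrink_bij (m : ℕ) :
    Set.BijOn (shrink (m := m + 1)) {A ∈ DeltaSet (m + 1 + 1 + 1) 2 | A 1 1 = 0}
      (DeltaSet (m + 1 + 1) 2) := by
  refine ⟨?_, ?_, ?_⟩
  · rintro A ⟨hA, h11⟩
    rw [mem_delta] at hA ⊢
    refine ⟨shrink_rowOK hA.1 hA.2 h11, ?_⟩
    rw [shrink_tr]
    exact shrink_rowOK hA.2 hA.1 h11
  · rintro A ⟨hA, h11⟩ B ⟨hB, h11'⟩ hAB
    rw [mem_delta] at hA hB
    rw [← grow_shrink hA.1 hA.2 h11, ← grow_shrink hB.1 hB.2 h11', hAB]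
  · intro B hB
    rw [mem_delta] at hB
    refine ⟨grow B, ⟨?_, ?_⟩, shrink_grow (first_row hB.1 hB.2).1⟩
    · rw [mem_delta]
      refine ⟨grow_rowOK hB.1 hB.2, ?_⟩
      rw [grow_tr]
      exact grow_rowOK hB.2 hB.1
    · change grow B (Fin.succ 0) (Fin.succ 0) = 0
      simp only [grow, Fin.cases_succ]
      simp

/-- Theorem (0-indexed): changing the entry `a_{11}` from `0` to `1` and deleting the first row
and column is a bijection from `{A ∈ Δ_{n+2}^2 | a_{11} = 0}` onto `Δ_{n+1}^2`; in particular
that set has cardinality `δ(n+1,2)`. -/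
theorem delta_two_case_zero (n : ℕ) (hn : 2 ≤ n) :
    Set.BijOn
      (fun (A : Fin (n + 2) → Fin (n + 2) → Fin 2) (i j : Fin (n + 1)) =>
        if (i : ℕ) = 0 ∧ (j : ℕ) = 0 then 1 else
          A ⟨(i : ℕ) + 1, by have := i.isLt; omega⟩ ⟨(j : ℕ) + 1, by have := j.isLt; omega⟩)
      {A ∈ DeltaSet (n + 2) 2 | A ⟨1, by omega⟩ ⟨1, by omega⟩ = 0}
      (DeltaSet (n + 1) 2) ∧
    {A ∈ DeltaSet (n + 2) 2 | A ⟨1, by omega⟩ ⟨1, by omega⟩ = 0}.ncard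
      = deltaCard (n + 1) 2 := by
  obtain ⟨m, rfl⟩ : ∃ m, n = m + 1 := ⟨n - 1, by omega⟩
  have key := shrink_bij m
  refine ⟨key, ?_⟩
  have h := key.injOn.ncard_image
  rw [key.image_eq] at h
  exact h.symm
end

section
/- For every nonnegative integer n, f_n = γ(n+2,n), where f_n is the n-th Fibonacci number with the convention f_0 = f_1 = 1 and f_n = f_{n−1} + f_{n−2} for n ≥ 2. -/
/-- The Fibonacci sequence with the convention `f_0 = f_1 = 1`. -/
def fibP : ℕ → ℕ
  | 0 => 1
  | 1 => 1
  | n + 2 => fibP (n + 1) + fibP n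


/-- Combinatorial content: pattern `Z` of zeros in an `N × N` matrix. -/
structure HalfPat (N : ℕ) (Z : ℕ → ℕ → Prop) : Prop where
  bd : ∀ i j, Z i j → i < N ∧ j < N
  two : ∀ i, i < N → ∃ a b, a < b ∧ ∀ j, Z i j ↔ j = a ∨ j = b
  lex : ∀ i j j', i < N → j < j' → j' < N → (∀ i', i' < i → (Z i' j ↔ Z i' j')) → Z i j' → Z i j

def CutAt (Z : ℕ → ℕ → Prop) (k : ℕ) : Prop := ∀ i j, Z i j → (i < k ↔ j < k)

def HalfOpen (Z : ℕ → ℕ → Prop) (k : ℕ) : Prop :=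
  Z (k - 1) k ∧ ∀ i j, Z i j → i < k → k ≤ j → i + 1 = k ∧ j = k

lemma cutAt_swap {Z : ℕ → ℕ → Prop} {k : ℕ} (h : CutAt Z k) : CutAt (fun i j => Z j i) k :=
  fun i j hz => (h j i hz).symm

lemma half_cut {N : ℕ} {Z : ℕ → ℕ → Prop} (h : HalfPat N Z) {k : ℕ} (hk : k < N)
    (hc : CutAt Z k) : ∀ j, Z k j ↔ j = k ∨ j = k + 1 := by
  obtain ⟨a, b, hab, hz⟩ := h.two k hk
  have hza : Z k a := (hz a).2 (Or.inl rfl)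
  have hzb : Z k b := (hz b).2 (Or.inr rfl)
  have key : ∀ j j', k ≤ j → j < j' → Z k j' → Z k j := by
    intro j j' h1 h2 h3
    refine h.lex k j j' hk h2 (h.bd _ _ h3).2 ?_ h3
    intro i' hi'
    constructor
    · intro hh; have := hc _ _ hh; omega
    · intro hh; have := hc _ _ hh; omega
  have ha := hc _ _ hza
  have hb := hc _ _ hzb
  have h1 : Z k k := key k b le_rfl (by omega) hzb
  have h2 : a = k := by have := (hz k).1 h1; omega
  have h3 : b = k + 1 := by
    by_contra hne
    have := (hz (k + 1)).1 (key (k + 1) b (by omega) (by omega) hzb)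
    omega
  subst h2; subst h3; exact hz

lemma half_open {N : ℕ} {Z : ℕ → ℕ → Prop} (h : HalfPat N Z) {k : ℕ} (hk : k < N) (hk1 : 1 ≤ k)
    (h1 : HalfOpen Z k) (h2 : HalfOpen (fun i j => Z j i) k) :
    ∀ j, Z k j ↔ j = k - 1 ∨ (j = k ∧ Z k k) ∨ (j = k + 1 ∧ ¬ Z k k) := by
  obtain ⟨a, b, hab, hz⟩ := h.two k hk
  have hzb : Z k b := (hz b).2 (Or.inr rfl)
  have hl : Z k (k - 1) := h2.1
  have hlow : ∀ j, Z k j → j < k → j = k - 1 := by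
    intro j hj hjk
    have := h2.2 j k hj hjk le_rfl
    omega
  have ha : a = k - 1 := by
    have h3 := (hz (k - 1)).1 hl
    rcases h3 with h3 | h3
    · exact h3.symm
    · have := hlow a ((hz a).2 (Or.inl rfl)) (by omega)
      omega
  have hbk : k ≤ b := by omega
  have key : ∀ j j', k < j → j < j' → Z k j' → Z k j := by
    intro j j' h4 h5 h3
    refine h.lex k j j' hk h5 (h.bd _ _ h3).2 ?_ h3
    intro i' hi'
    constructor
    · intro hh; have := h1.2 _ _ hh hi' (by omega); omega
    · intro hh; have := h1.2 _ _ hh hi' (by omega); omega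
  have hb : b = k ∨ b = k + 1 := by
    by_contra hne
    have := (hz (k + 1)).1 (key (k + 1) b (by omega) (by omega) hzb)
    omega
  have hkk := hz k
  intro j
  rw [hz j, hkk]
  omega

lemma cut_or_open {N : ℕ} {Z : ℕ → ℕ → Prop} (h : HalfPat N Z) (h' : HalfPat N (fun i j => Z j i)) :
    ∀ k, k ≤ N → CutAt Z k ∨ (1 ≤ k ∧ HalfOpen Z k ∧ HalfOpen (fun i j => Z j i) k) := by
  intro k
  induction k with
  | zero => intro _; left; intro i j _; simp
  | succ k ih =>
    intro hk
    have hk' : k < N := hk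
    rcases ih (by omega) with hc | ⟨hk1, ho, ho'⟩
    · right
      have r := half_cut h hk' hc
      have r' := half_cut h' hk' (cutAt_swap hc)
      refine ⟨by omega, ⟨(r _).2 (Or.inr rfl), ?_⟩, ⟨(r' _).2 (Or.inr rfl), ?_⟩⟩
      · intro i j hz hi hj
        by_cases hik : i = k
        · subst hik; have := (r j).1 hz; omega
        · have := hc _ _ hz; omega
      · intro i j hz hi hj
        by_cases hik : i = k
        · subst hik; have := (r' j).1 hz; omega
        · have := hc _ _ hz; omega
    · have r := half_open h hk' hk1 ho ho'
      have r' := half_open h' hk' hk1 ho' ho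
      by_cases hkk : Z k k
      · left
        simp only [hkk, and_true, not_true, and_false, or_false] at r r'
        intro i j hz
        by_cases hik : i = k
        · subst hik; have := (r j).1 hz; omega
        by_cases hjk : j = k
        · subst hjk; have := (r' i).1 hz; omega
        have := ho.2 i j hz
        have := ho'.2 j i hz
        omega
      · right
        simp only [hkk, and_true, not_false_eq_true, and_false, false_or] at r r'
        refine ⟨by omega, ⟨(r _).2 (Or.inr rfl), ?_⟩, ⟨(r' _).2 (Or.inr rfl), ?_⟩⟩
        · intro i j hz hi hj
          by_cases hik : i = k
          · subst hik; have := (r j).1 hz; omega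
          · have := ho.2 _ _ hz; 
            by_cases hjk : j = k
            · omega
            · omega
        · intro i j hz hi hj
          by_cases hik : i = k
          · subst hik; have := (r' j).1 hz; omega
          · have := ho'.2 _ _ hz; omega

/-- The band pattern attached to a cut predicate. -/
def Band (c : ℕ → Prop) (i j : ℕ) : Prop :=
  (j = i + 1 ∧ ¬ c j) ∨ (i = j + 1 ∧ ¬ c i) ∨ (i = j ∧ (c i ∨ c (i + 1)))

lemma band_swap (c : ℕ → Prop) (i j : ℕ) : Band c i j ↔ Band c j i := by
  unfold Band
  constructor
  · rintro (⟨rfl, h⟩ | ⟨rfl, h⟩ | ⟨rfl, h⟩) <;> simp [h]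
  · rintro (⟨rfl, h⟩ | ⟨rfl, h⟩ | ⟨rfl, h⟩) <;> simp [h]

lemma no_adj {N : ℕ} {Z : ℕ → ℕ → Prop} (h : HalfPat N Z) {k : ℕ} (hk : k < N)
    (h1 : CutAt Z k) (h2 : CutAt Z (k + 1)) : False := by
  have r := half_cut h hk h1
  have := h2 _ _ ((r (k + 1)).2 (Or.inr rfl))
  omega

lemma pattern_eq {N : ℕ} {Z : ℕ → ℕ → Prop} (h : HalfPat N Z) (h' : HalfPat N (fun i j => Z j i))
    {i j : ℕ} (hi : i < N) (hj : j < N) : Z i j ↔ Band (CutAt Z) i j := by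
  have H := cut_or_open h h'
  have up : ∀ i, i + 1 ≤ N → (Z i (i + 1) ↔ ¬ CutAt Z (i + 1)) := by
    intro i hi
    constructor
    · intro hz hc; have := hc _ _ hz; omega
    · intro hc; exact ((H (i + 1) hi).resolve_left hc).2.1.1
  have dn : ∀ i, i + 1 ≤ N → (Z (i + 1) i ↔ ¬ CutAt Z (i + 1)) := by
    intro i hi
    constructor
    · intro hz hc; have := hc _ _ hz; omega
    · intro hc; exact ((H (i + 1) hi).resolve_left hc).2.2.1
  rcases lt_trichotomy i j with hij | hij | hij
  · have hb : Band (CutAt Z) i j ↔ (j = i + 1 ∧ ¬ CutAt Z j) := by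
      unfold Band
      constructor
      · rintro (h | h | h)
        · exact h
        · omega
        · omega
      · exact Or.inl
    rw [hb]
    constructor
    · intro hz
      rcases H (i + 1) hi with hc | ⟨_, ho, _⟩
      · have := hc _ _ hz; omega
      · have := ho.2 _ _ hz (by omega) (by omega)
        obtain ⟨_, rfl⟩ := this
        exact ⟨rfl, (up i hi).1 hz⟩
    · rintro ⟨rfl, hc⟩
      exact (up i hi).2 hc
  · subst hij
    have hb : Band (CutAt Z) i i ↔ (CutAt Z i ∨ CutAt Z (i + 1)) := by
      unfold Band; simp
    rw [hb]
    rcases H i hi.le with hc | ⟨h1, ho, ho'⟩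
    · simp only [hc, true_or, iff_true]
      exact (half_cut h hi hc i).2 (Or.inl rfl)
    · have r := half_open h hi h1 ho ho'
      have hnc : ¬ CutAt Z i := by
        intro hc; have := hc _ _ ho.1; omega
      have := (up i hi)
      rw [r (i + 1)] at this
      simp only [hnc, false_or]
      constructor
      · intro hz
        by_contra hcc
        have := this.2 hcc
        simp [hz] at this
        omega
      · intro hcc
        by_contra hz
        exact this.1 (Or.inr (Or.inr ⟨rfl, hz⟩)) hcc
  · have hb : Band (CutAt Z) i j ↔ (i = j + 1 ∧ ¬ CutAt Z i) := by
      unfold Band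
      constructor
      · rintro (h | h | h)
        · omega
        · exact h
        · omega
      · exact fun h => Or.inr (Or.inl h)
    rw [hb]
    constructor
    · intro hz
      rcases H (j + 1) hj with hc | ⟨_, _, ho⟩
      · have := hc _ _ hz; omega
      · have := ho.2 _ _ hz (by omega) (by omega)
        obtain ⟨_, rfl⟩ := this
        exact ⟨rfl, (dn j hj).1 hz⟩
    · rintro ⟨rfl, hc⟩
      exact (dn j hj).2 hc

/-- Families of cut sets. -/
def cutFam : ℕ → Finset (Finset ℕ)
  | 0 => {∅}
  | 1 => {∅}
  | n + 2 => cutFam (n + 1) ∪ (cutFam n).image (insert (n + 2))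

def Good (n : ℕ) (S : Finset ℕ) : Prop := ∀ x ∈ S, 2 ≤ x ∧ x ≤ n ∧ x + 1 ∉ S

lemma mem_cutFam (n : ℕ) : ∀ S, S ∈ cutFam n ↔ Good n S := by
  induction n using Nat.strong_induction_on with
  | _ n ih =>
    intro S
    match n, ih with
    | 0, _ =>
      simp only [cutFam, Finset.mem_singleton, Good]
      constructor
      · rintro rfl; simp
      · intro h; ext x; simp; intro hx; have := h x hx; omega
    | 1, _ =>
      simp only [cutFam, Finset.mem_singleton, Good]
      constructor
      · rintro rfl; simp
      · intro h; ext x; simp; intro hx; have := h x hx; omega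
    | n + 2, ih =>
      simp only [cutFam, Finset.mem_union, Finset.mem_image]
      rw [ih (n + 1) (by omega)]
      constructor
      · rintro (h | ⟨T, hT, rfl⟩)
        · intro x hx; have := h x hx; exact ⟨this.1, by omega, this.2.2⟩
        · rw [ih n (by omega)] at hT
          intro x hx
          rw [Finset.mem_insert] at hx
          rcases hx with rfl | hx
          · refine ⟨by omega, le_rfl, ?_⟩
            intro hx
            rw [Finset.mem_insert] at hx
            rcases hx with hx | hx
            · omega
            · have := hT _ hx; omega
          · have := hT x hx
            refine ⟨this.1, by omega, ?_⟩
            intro hx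
            rw [Finset.mem_insert] at hx
            rcases hx with hx | hx
            · omega
            · exact this.2.2 hx
      · intro h
        by_cases hm : n + 2 ∈ S
        · right
          refine ⟨S.erase (n + 2), ?_, Finset.insert_erase hm⟩
          rw [ih n (by omega)]
          intro x hx
          rw [Finset.mem_erase] at hx
          have h3 := h x hx.2
          refine ⟨h3.1, ?_, fun hx' => h3.2.2 (Finset.mem_of_mem_erase hx')⟩
          by_contra hlt
          have : x = n + 1 := by omega
          subst this
          exact h3.2.2 hm
        · left
          intro x hx
          have h3 := h x hx
          have : x ≠ n + 2 := by rintro rfl; exact hm hx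
          exact ⟨h3.1, by omega, h3.2.2⟩

lemma card_cutFam (n : ℕ) : (cutFam n).card = fibP n := by
  induction n using Nat.strong_induction_on with
  | _ n ih =>
    match n, ih with
    | 0, _ => rfl
    | 1, _ => rfl
    | n + 2, ih =>
      rw [cutFam, fibP, Finset.card_union_of_disjoint, Finset.card_image_of_injOn,
        ih (n + 1) (by omega), ih n (by omega)]
      · intro S hS T hT hST
        have hS' := (mem_cutFam n S).1 hS
        have hT' := (mem_cutFam n T).1 hT
        have h1 : n + 2 ∉ S := fun hh => by have := hS' _ hh; omega
        have h2 : n + 2 ∉ T := fun hh => by have := hT' _ hh; omega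
        rw [← Finset.erase_insert h1, ← Finset.erase_insert h2]
        exact congrArg (fun U => Finset.erase U (n + 2)) hST
      · rw [Finset.disjoint_left]
        intro S hS hS2
        obtain ⟨T, _, rfl⟩ := Finset.mem_image.1 hS2
        have := (mem_cutFam _ _).1 hS (n + 2) (Finset.mem_insert_self _ _)
        omega

/-- Binary value of a word. -/
def wval {m : ℕ} (f : Fin m → Fin 2) : ℕ := ∑ j : Fin m, (f j : ℕ) * 2 ^ (m - 1 - (j : ℕ))

lemma wval_succ {m : ℕ} (f : Fin (m + 1) → Fin 2) :
    wval f = (f 0 : ℕ) * 2 ^ m + wval (fun j => f j.succ) := by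
  unfold wval
  rw [Fin.sum_univ_succ]
  congr 1
  apply Finset.sum_congr rfl
  intro j _
  congr 2
  simp
  omega

lemma wval_lt {m : ℕ} (f : Fin m → Fin 2) : wval f < 2 ^ m := by
  induction m with
  | zero => simp [wval]
  | succ m ih =>
    rw [wval_succ, pow_succ]
    have := ih (fun j => f j.succ)
    have h2 : (f 0 : ℕ) ≤ 1 := by omega
    nlinarith [Nat.mul_le_mul_right (2 ^ m) h2]

lemma wval_lex {m : ℕ} (f g : Fin m → Fin 2) (i : Fin m) (h : ∀ i' < i, f i' = g i')
    (hf : f i = 0) (hg : g i ≠ 0) : wval f < wval g := by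
  induction m with
  | zero => exact i.elim0
  | succ m ih =>
    rw [wval_succ, wval_succ]
    induction i using Fin.cases with
    | zero =>
      rw [hf]
      have : (g 0 : ℕ) = 1 := by omega
      rw [this]
      have := wval_lt (fun j => f j.succ)
      simp
      omega
    | succ i =>
      rw [h 0 (Fin.succ_pos i)]
      have := ih (fun j => f j.succ) (fun j => g j.succ) i
        (fun i' hi' => h _ (Fin.succ_lt_succ_iff.2 hi')) hf hg
      omega

lemma sum_add_zeros {m : ℕ} (f : Fin m → Fin 2) :
    ∑ j, (f j : ℕ) + (Finset.univ.filter (fun j => f j = 0)).card = m := by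
  rw [Finset.card_filter, ← Finset.sum_add_distrib]
  have : ∀ j, (f j : ℕ) + (if f j = 0 then 1 else 0) = 1 := by
    intro j
    split_ifs with h
    · simp [h]
    · omega
  simp [this]

/-- The zero pattern of a matrix. -/
def Zof {N : ℕ} (A : Fin N → Fin N → Fin 2) (i j : ℕ) : Prop :=
  ∃ (hi : i < N) (hj : j < N), A ⟨i, hi⟩ ⟨j, hj⟩ = 0

lemma zof_swap {N : ℕ} (A : Fin N → Fin N → Fin 2) :
    Zof (fun i j => A j i) = fun i j => Zof A j i := by
  funext i j
  unfold Zof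
  exact propext ⟨fun ⟨a, b, c⟩ => ⟨b, a, c⟩, fun ⟨a, b, c⟩ => ⟨b, a, c⟩⟩

lemma halfPat_of {n : ℕ} (A : Fin (n + 2) → Fin (n + 2) → Fin 2)
    (hs : ∀ i, ∑ j, (A i j : ℕ) = n) (hm : Monotone (fun j => wval (fun i => A i j))) :
    HalfPat (n + 2) (Zof A) := by
  refine ⟨fun i j ⟨a, b, _⟩ => ⟨a, b⟩, ?_, ?_⟩
  · intro i hi
    have h1 := sum_add_zeros (A ⟨i, hi⟩)
    rw [hs] at h1
    have h2 : (Finset.univ.filter (fun j => A ⟨i, hi⟩ j = 0)).card = 2 := by omega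
    obtain ⟨x, y, hxy, hS⟩ := Finset.card_eq_two.1 h2
    have h3 : ∀ j : Fin (n + 2), A ⟨i, hi⟩ j = 0 ↔ j = x ∨ j = y := by
      intro j
      have : j ∈ Finset.univ.filter (fun j => A ⟨i, hi⟩ j = 0) ↔ j ∈ ({x, y} : Finset _) := by
        rw [hS]
      simpa using this
    have h4 : ∀ j : ℕ, Zof A i j ↔ j = x ∨ j = y := by
      intro j
      constructor
      · rintro ⟨_, hj, hz⟩
        rcases (h3 _).1 hz with h | h
        · left; rw [← h]
        · right; rw [← h]
      · rintro (rfl | rfl)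
        · exact ⟨hi, x.2, (h3 x).2 (Or.inl rfl)⟩
        · exact ⟨hi, y.2, (h3 y).2 (Or.inr rfl)⟩
    have hne : (x : ℕ) ≠ y := fun h => hxy (Fin.ext h)
    rcases lt_or_gt_of_ne hne with h | h
    · exact ⟨x, y, h, h4⟩
    · exact ⟨y, x, h, fun j => (h4 j).trans or_comm⟩
  · intro i j j' hi hjj hj' hag hz
    obtain ⟨_, _, hz⟩ := hz
    refine ⟨hi, hjj.trans hj', ?_⟩
    by_contra hne
    have h1 := wval_lex (fun i => A i ⟨j', hj'⟩) (fun i => A i ⟨j, hjj.trans hj'⟩) ⟨i, hi⟩ ?_ hz hne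
    · have h2 := @hm ⟨j, hjj.trans hj'⟩ ⟨j', hj'⟩ hjj.le
      exact absurd h1 (not_lt.2 h2)
    · intro i' hi'
      have h2 := hag i' hi'
      have h3 : A i' ⟨j, hjj.trans hj'⟩ = 0 ↔ A i' ⟨j', hj'⟩ = 0 :=
        ⟨fun h => (h2.1 ⟨i'.2, _, h⟩).2.2, fun h => (h2.2 ⟨i'.2, _, h⟩).2.2⟩
      show A i' ⟨j', hj'⟩ = A i' ⟨j, hjj.trans hj'⟩
      omega

def cutP (n : ℕ) (S : Finset ℕ) (k : ℕ) : Prop := k = 0 ∨ k = n + 2 ∨ k ∈ S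

open Classical in
/-- The matrix attached to a set of cuts. -/
noncomputable def phi (n : ℕ) (S : Finset ℕ) (i j : Fin (n + 2)) : Fin 2 :=
  if Band (cutP n S) i j then 0 else 1

lemma phi_zero {n : ℕ} {S : Finset ℕ} {i j : Fin (n + 2)} :
    phi n S i j = 0 ↔ Band (cutP n S) i j := by
  unfold phi; split_ifs with h <;> simp [h]

lemma phi_symm (n : ℕ) (S : Finset ℕ) (i j : Fin (n + 2)) : phi n S i j = phi n S j i := by
  have h1 := @phi_zero n S i j
  have h2 := @phi_zero n S j i
  rw [band_swap, ← h2] at h1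
  omega

lemma cutP_no_adj {n : ℕ} {S : Finset ℕ} (hS : Good n S) {k : ℕ} (hk : k < n + 2)
    (h1 : cutP n S k) : ¬ cutP n S (k + 1) := by
  rintro (h2 | h2 | h2)
  · omega
  · rcases h1 with h1 | h1 | h1
    · omega
    · omega
    · have := hS _ h1; omega
  · rcases h1 with h1 | h1 | h1
    · have := hS _ h2; omega
    · omega
    · exact (hS _ h1).2.2 h2

lemma phi_rowsum {n : ℕ} {S : Finset ℕ} (hS : Good n S) (i : Fin (n + 2)) :
    ∑ j, (phi n S i j : ℕ) = n := by
  have h1 := sum_add_zeros (phi n S i)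
  suffices h2 : (Finset.univ.filter (fun j => phi n S i j = 0)).card = 2 by omega
  rw [Finset.card_eq_two]
  have h0 : cutP n S 0 := Or.inl rfl
  have hN : cutP n S (n + 2) := Or.inr (Or.inl rfl)
  have hadj := @cutP_no_adj n S hS i i.2
  obtain ⟨i, hi⟩ := i
  simp only at hadj
  by_cases hc : cutP n S i
  · have hc' := hadj hc
    have hi1 : i + 1 < n + 2 := by
      by_contra hh
      have : i + 1 = n + 2 := by omega
      rw [this] at hc'; exact hc' hN
    refine ⟨⟨i, hi⟩, ⟨i + 1, hi1⟩, by simp, ?_⟩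
    ext ⟨j, hj⟩
    simp only [Finset.mem_filter, Finset.mem_univ, true_and, phi_zero, Finset.mem_insert,
      Finset.mem_singleton, Fin.mk.injEq, Band]
    constructor
    · rintro (h | h | h)
      · exact Or.inr h.1
      · exact absurd hc h.2
      · exact Or.inl h.1.symm
    · rintro (rfl | rfl)
      · exact Or.inr (Or.inr ⟨rfl, Or.inl hc⟩)
      · exact Or.inl ⟨rfl, hc'⟩
  · obtain ⟨k, rfl⟩ : ∃ k, i = k + 1 := by
      cases i with
      | zero => exact absurd h0 hc
      | succ k => exact ⟨k, rfl⟩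
    by_cases hc' : cutP n S (k + 1 + 1)
    · refine ⟨⟨k, by omega⟩, ⟨k + 1, hi⟩, by simp, ?_⟩
      ext ⟨j, hj⟩
      simp only [Finset.mem_filter, Finset.mem_univ, true_and, phi_zero, Finset.mem_insert,
        Finset.mem_singleton, Fin.mk.injEq, Band]
      constructor
      · rintro (⟨rfl, h⟩ | h | h)
        · exact absurd hc' h
        · left; omega
        · right; omega
      · rintro (rfl | rfl)
        · exact Or.inr (Or.inl ⟨rfl, hc⟩)
        · exact Or.inr (Or.inr ⟨rfl, Or.inr hc'⟩)
    · have hi1 : k + 1 + 1 < n + 2 := by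
        by_contra hh
        have : k + 1 + 1 = n + 2 := by omega
        rw [this] at hc'; exact hc' hN
      refine ⟨⟨k, by omega⟩, ⟨k + 1 + 1, hi1⟩, by simp; omega, ?_⟩
      ext ⟨j, hj⟩
      simp only [Finset.mem_filter, Finset.mem_univ, true_and, phi_zero, Finset.mem_insert,
        Finset.mem_singleton, Fin.mk.injEq, Band]
      constructor
      · rintro (h | h | h)
        · right; omega
        · left; omega
        · rcases h.2 with h | h
          · exact absurd h hc
          · exact absurd h hc'
      · rintro (rfl | rfl)
        · exact Or.inr (Or.inl ⟨rfl, hc⟩)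
        · exact Or.inl ⟨rfl, hc'⟩

lemma fin2_ext {a b : Fin 2} (h : a = 0 ↔ b = 0) : a = b := by omega

lemma phi_mono {n : ℕ} {S : Finset ℕ} (hS : Good n S) :
    Monotone (fun i => wval (phi n S i)) := by
  rw [Fin.monotone_iff_le_succ]
  rintro ⟨i, hi⟩
  simp only [Fin.castSucc_mk, Fin.succ_mk]
  have hadj := @cutP_no_adj n S hS i (by omega)
  by_cases hc : cutP n S i
  · have hc' := hadj hc
    by_cases hc2 : cutP n S (i + 1 + 1)
    · apply le_of_eq
      congr 1
      funext ⟨j, hj⟩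
      apply fin2_ext
      simp only [phi_zero, Band]
      constructor
      · rintro (h | h | h)
        · exact Or.inr (Or.inr ⟨h.1.symm, Or.inr hc2⟩)
        · exact absurd hc h.2
        · exact Or.inr (Or.inl ⟨by omega, hc'⟩)
      · rintro (⟨rfl, h⟩ | ⟨h, _⟩ | h)
        · exact absurd hc2 h
        · exact Or.inr (Or.inr ⟨by omega, Or.inl hc⟩)
        · obtain ⟨rfl, h⟩ := h
          exact Or.inl ⟨rfl, hc'⟩
    · apply le_of_lt
      apply wval_lex _ _ ⟨i + 1, by omega⟩
      · rintro ⟨j, hj⟩ hlt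
        have hlt : j < i + 1 := hlt
        apply fin2_ext
        simp only [phi_zero, Band]
        constructor
        · rintro (h | h | h)
          · omega
          · exact absurd hc h.2
          · exact Or.inr (Or.inl ⟨by omega, hc'⟩)
        · rintro (h | h | h)
          · omega
          · exact Or.inr (Or.inr ⟨by omega, Or.inl hc⟩)
          · omega
      · rw [phi_zero]; exact Or.inl ⟨rfl, hc'⟩
      · rw [Ne, phi_zero]
        rintro (h | h | h)
        · simp at h
        · simp at h
        · exact h.2.elim hc' hc2
  · obtain ⟨k, rfl⟩ : ∃ k, i = k + 1 := by
      cases i with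
      | zero => exact absurd (Or.inl rfl) hc
      | succ k => exact ⟨k, rfl⟩
    apply le_of_lt
    apply wval_lex _ _ ⟨k, by omega⟩
    · rintro ⟨j, hj⟩ hlt
      have hlt : j < k := hlt
      apply fin2_ext
      simp only [phi_zero, Band]
      constructor
      · rintro (h | h | h) <;> omega
      · rintro (h | h | h) <;> omega
    · rw [phi_zero]; exact Or.inr (Or.inl ⟨rfl, hc⟩)
    · rw [Ne, phi_zero]
      simp only [Band]
      rintro (h | h | h) <;> omega

lemma phi_mem {n : ℕ} {S : Finset ℕ} (hS : Good n S) : phi n S ∈ GammaSet (n + 2) n := by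
  refine ⟨⟨phi_mono hS, ?_⟩, phi_rowsum hS, ?_⟩
  · intro a b hab
    have := phi_mono hS hab
    have h1 : ∀ c, colVal (phi n S) c = wval (phi n S c) := by
      intro c
      unfold colVal wval
      exact Finset.sum_congr rfl (fun i _ => by rw [phi_symm])
    rw [h1, h1]; exact this
  · intro j
    refine Eq.trans ?_ (phi_rowsum hS j)
    exact Finset.sum_congr rfl (fun i _ => by rw [phi_symm])

lemma phi_inj {n : ℕ} {S T : Finset ℕ} (hS : Good n S) (hT : Good n T)
    (h : phi n S = phi n T) : S ⊆ T := by
  intro k hk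
  have h1 := hS k hk
  by_contra hkT
  have h2 : phi n T ⟨k - 1, by omega⟩ ⟨k, by omega⟩ = 0 := by
    rw [phi_zero]
    refine Or.inl ⟨by simp only; omega, ?_⟩
    rintro (h | h | h)
    · simp only at h; omega
    · simp only at h; omega
    · exact hkT h
  rw [← h, phi_zero] at h2
  rcases h2 with h2 | h2 | h2
  · exact h2.2 (Or.inr (Or.inr hk))
  · simp only at h2; omega
  · simp only at h2; omega

open Classical in
lemma exists_phi {n : ℕ} {A : Fin (n + 2) → Fin (n + 2) → Fin 2} (hA : A ∈ GammaSet (n + 2) n) :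
    ∃ S, Good n S ∧ phi n S = A := by
  obtain ⟨⟨hr, hc⟩, hsr, hsc⟩ := hA
  have h : HalfPat (n + 2) (Zof A) := halfPat_of A hsr hc
  have h' : HalfPat (n + 2) (fun i j => Zof A j i) := by
    rw [← zof_swap]
    exact halfPat_of (fun i j => A j i) hsc hr
  have c0 : CutAt (Zof A) 0 := by intro i j _; simp
  have cN : CutAt (Zof A) (n + 2) := by
    intro i j hz; have := h.bd _ _ hz; omega
  have hmem : ∀ k, k ∈ (Finset.Icc 1 (n + 1)).filter (CutAt (Zof A)) ↔
      (1 ≤ k ∧ k ≤ n + 1) ∧ CutAt (Zof A) k := by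
    intro k; rw [Finset.mem_filter, Finset.mem_Icc]
  refine ⟨(Finset.Icc 1 (n + 1)).filter (CutAt (Zof A)), ?_, ?_⟩
  · intro k hk
    rw [hmem] at hk
    obtain ⟨⟨h1, h2⟩, hk⟩ := hk
    refine ⟨?_, ?_, ?_⟩
    · by_contra hlt
      have : k = 0 + 1 := by omega
      subst this
      exact no_adj h (by omega) c0 hk
    · by_contra hlt
      have : k = n + 1 := by omega
      subst this
      exact no_adj h (by omega) hk cN
    · rw [hmem]
      rintro ⟨_, hk'⟩
      exact no_adj h (by omega) hk hk'
  · have hcut : ∀ k, k ≤ n + 2 →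
        (cutP n ((Finset.Icc 1 (n + 1)).filter (CutAt (Zof A))) k ↔ CutAt (Zof A) k) := by
      intro k hk
      unfold cutP
      rw [hmem]
      constructor
      · rintro (rfl | rfl | h)
        · exact c0
        · exact cN
        · exact h.2
      · intro hck
        by_cases h0 : k = 0
        · exact Or.inl h0
        by_cases h1 : k = n + 2
        · exact Or.inr (Or.inl h1)
        exact Or.inr (Or.inr ⟨by omega, hck⟩)
    funext i j
    apply fin2_ext
    rw [phi_zero]
    have h1 : A i j = 0 ↔ Zof A i j := ⟨fun hz => ⟨i.2, j.2, hz⟩, fun ⟨_, _, hz⟩ => hz⟩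
    rw [h1, pattern_eq h h' i.2 j.2]
    unfold Band
    rw [hcut i (by omega), hcut j (by omega), hcut (i + 1) (by omega)]

/-- Theorem: `f_n = γ(n+2,n)` for every `n ≥ 0`. -/
theorem fib_eq_gamma (n : ℕ) : fibP n = gammaCard (n + 2) n := by
  have h : GammaSet (n + 2) n = Set.image (phi n) (cutFam n : Set (Finset ℕ)) := by
    ext A
    constructor
    · intro hA
      obtain ⟨S, hS, rfl⟩ := exists_phi hA
      exact ⟨S, (mem_cutFam n S).2 hS, rfl⟩
    · rintro ⟨S, hS, rfl⟩
      exact phi_mem ((mem_cutFam n S).1 hS)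
  unfold gammaCard
  rw [h, Set.InjOn.ncard_image, Set.ncard_coe_finset, card_cutFam]
  intro S hS T hT hST
  have hS' := (mem_cutFam n S).1 hS
  have hT' := (mem_cutFam n T).1 hT
  exact Finset.Subset.antisymm (phi_inj hS' hT' hST) (phi_inj hT' hS' hST.symm)
end
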